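/- Let Γ be a countable discrete group and ρ a free IRE on Γ, i.e., the action Γ ↷ (E, ρ) is essentially free. Then ρ is an amenable IRE if and only if the restricted rerooting relation R_re is ρ-amenable, i.e., the restriction of R_re to some ρ-conull Γ-invariant (hence R_re-invariant) Borel subset of E is Borel amenable. -/

import Mathlib

open MeasureTheory Filter Topology

/-- A function `r : Γ × Γ → Bool` codes an equivalence relation on `Γ`. -/
def IsEqRel {Γ : Type*} (r : Γ × Γ → Bool) : Prop :=
  (∀ x, r (x, x) = true) ∧ (∀ x y, r (x, y) = true → r (y, x) = true) ∧
    (∀ x y z, r (x, y) = true → r (y, z) = true → r (x, z) = true)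

/-- The space `E` of equivalence relations on `Γ`, as a subspace of `{0,1}^{Γ×Γ}`. -/
abbrev EqRelSpace (Γ : Type*) : Type _ := ↥{r : Γ × Γ → Bool | IsEqRel r}

variable {Γ : Type*} [Group Γ]

/-- The left shift action of `Γ` on the space of equivalence relations:
`(γ·r)(x,y) = r(γ⁻¹x, γ⁻¹y)`. -/
def shiftE (γ : Γ) (r : EqRelSpace Γ) : EqRelSpace Γ :=
  ⟨fun p => r.1 (γ⁻¹ * p.1, γ⁻¹ * p.2),
    ⟨fun _ => r.2.1 _, fun _ _ h => r.2.2.1 _ _ h, fun _ _ _ h h' => r.2.2.2 _ _ _ h h'⟩⟩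

/-- The `r`-class of `g ∈ Γ`. -/
def classOf (r : EqRelSpace Γ) (g : Γ) : Set Γ := {h | r.1 (g, h) = true}

/-- An invariant random equivalence relation: a Borel probability measure on `E`
invariant under the left shift action. -/
def IsIRE (ρ : ProbabilityMeasure (EqRelSpace Γ)) : Prop :=
  ∀ γ : Γ, ρ.toMeasure.map (shiftE γ) = ρ.toMeasure

/-- An amenable IRE: there are Borel maps `λ_n : E → Prob(Γ)` (coded coordinatewise as
`lam : ℕ → E → Γ → ℝ`) such that for a.e. `r` and every `g` in the class of the identity,
`‖g⁻¹·λ_n^r − λ_n^{g⁻¹·r}‖₁ → 0`; here `(g⁻¹·λ_n^r)(h) = λ_n^r(gh)`. -/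
def IsAIRE {Γ : Type*} [Group Γ] (ρ : ProbabilityMeasure (EqRelSpace Γ)) : Prop :=
  IsIRE ρ ∧ ∃ lam : ℕ → EqRelSpace Γ → Γ → ℝ,
    (∀ n g, Measurable fun r => lam n r g) ∧
    (∀ n r g, 0 ≤ lam n r g) ∧
    (∀ n r, ∑' g, lam n r g = 1) ∧
    ∀ᵐ r ∂ρ.toMeasure, ∀ g ∈ classOf r 1,
      Tendsto (fun n => ∑' h : Γ, |lam n r (g * h) - lam n (shiftE g⁻¹ r) h|) atTop (𝓝 0)

/-- The restricted rerooting relation `R_re = {(r, γ⁻¹·r) : γ ∈ [e]_r}` on the space of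
equivalence relations. -/
def Rre {Γ : Type*} [Group Γ] (r t : EqRelSpace Γ) : Prop :=
  ∃ γ : Γ, r.1 (1, γ) = true ∧ t = shiftE γ⁻¹ r

/-- A countable Borel equivalence relation `S` on a measurable space `X` is Borel amenable:
there are Borel maps `η_n : S → ℝ≥0` (extended by `0` to `X × X`, with `η n x y` the mass
that `η_n^x := η_n(·,x)` puts at `y`) such that each `η_n^x` is a probability measure
supported on the `S`-class of `x` and `‖η_n^x − η_n^y‖₁ → 0` for all `(y,x) ∈ S`. -/
def BorelAmenableRel {X : Type*} [MeasurableSpace X] (S : X → X → Prop) : Prop :=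
  ∃ η : ℕ → X → X → ℝ,
    (∀ n, Measurable fun p : X × X => η n p.1 p.2) ∧
    (∀ n x y, 0 ≤ η n x y) ∧
    (∀ n x y, η n x y ≠ 0 → S y x) ∧
    (∀ n x, ∑' y : X, η n x y = 1) ∧
    ∀ x y, S y x → Tendsto (fun n => ∑' z : X, |η n x z - η n y z|) atTop (𝓝 0)

section ShiftAction

@[simp] lemma shiftE_one (r : EqRelSpace Γ) : shiftE 1 r = r := by
  ext p
  simp [shiftE]

lemma shiftE_shiftE (a b : Γ) (r : EqRelSpace Γ) : shiftE a (shiftE b r) = shiftE (a * b) r := by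
  ext p
  simp [shiftE, mul_assoc]

lemma shiftE_apply (a x y : Γ) (r : EqRelSpace Γ) :
    (shiftE a r).1 (x, y) = r.1 (a⁻¹ * x, a⁻¹ * y) := rfl

lemma measurable_eqRelSpace_coord {G : Type*} (p : G × G) :
    Measurable fun r : EqRelSpace G => r.1 p :=
  (measurable_pi_apply p).comp measurable_subtype_coe

lemma measurable_shiftE (a : Γ) : Measurable (shiftE a : EqRelSpace Γ → EqRelSpace Γ) :=
  Measurable.subtype_mk (measurable_pi_lambda _ fun _ => measurable_eqRelSpace_coord _)

lemma measurableSet_eqRelSpace_eq {G : Type*} [Countable G] {α : Type*} [MeasurableSpace α]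
    {f g : α → EqRelSpace G} (hf : Measurable f) (hg : Measurable g) :
    MeasurableSet {x | f x = g x} := by
  have : {x | f x = g x} = ⋂ p : G × G, {x | (f x).1 p = (g x).1 p} := by
    ext x
    simp only [Set.mem_ofPred_eq, Set.mem_iInter, Subtype.ext_iff, funext_iff]
  rw [this]
  exact MeasurableSet.iInter fun p =>
    measurableSet_eq_fun ((measurable_eqRelSpace_coord p).comp hf)
      ((measurable_eqRelSpace_coord p).comp hg)

/-- The points of the space of equivalence relations with trivial stabilizer. -/
def freePart (Γ : Type*) [Group Γ] : Set (EqRelSpace Γ) :=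
  {r | ∀ γ : Γ, γ ≠ 1 → shiftE γ r ≠ r}

lemma measurableSet_freePart [Countable Γ] : MeasurableSet (freePart Γ) := by
  have : freePart Γ = ⋂ γ : Γ, ⋂ _ : γ ≠ 1, {r : EqRelSpace Γ | shiftE γ r = r}ᶜ := by
    ext r
    simp [freePart]
  rw [this]
  exact MeasurableSet.iInter fun γ => MeasurableSet.iInter fun _ =>
    (measurableSet_eqRelSpace_eq (measurable_shiftE γ) measurable_id).compl

lemma shiftE_left_injective {r : EqRelSpace Γ} (hr : r ∈ freePart Γ) :
    Function.Injective fun γ : Γ => shiftE γ r := by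
  intro a b hab
  by_contra hne
  refine hr (b⁻¹ * a) (fun h => hne (inv_mul_eq_one.1 h).symm) ?_
  have := congrArg (shiftE b⁻¹) hab
  simpa [shiftE_shiftE] using this

lemma shiftE_mem_freePart (a : Γ) {r : EqRelSpace Γ} (hr : r ∈ freePart Γ) :
    shiftE a r ∈ freePart Γ := by
  intro γ hγ h
  rw [shiftE_shiftE] at h
  exact hγ (by simpa using shiftE_left_injective hr h)

lemma Rre.symm {r t : EqRelSpace Γ} (h : Rre r t) : Rre t r := by
  obtain ⟨γ, hγ, rfl⟩ := h
  refine ⟨γ⁻¹, ?_, by simp [shiftE_shiftE]⟩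
  simpa [shiftE_apply] using r.2.2.1 _ _ hγ

end ShiftAction

section Pushforward

variable {α β : Type*}

/-- The push-forward of a function along `f`, summing over the fibers of `f`. -/
noncomputable def fiberSum (f : α → β) (a : α → ℝ) (z : β) : ℝ :=
  ∑' h, (f ⁻¹' {z}).indicator a h

lemma hasSum_fiberSum (f : α → β) {a : α → ℝ} (ha : Summable a) :
    HasSum (fiberSum f a) (∑' h, a h) := by
  have h1 : HasSum (a ∘ Equiv.sigmaFiberEquiv f) (∑' h, a h) :=
    (Equiv.sigmaFiberEquiv f).hasSum_iff.2 ha.hasSum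
  refine h1.sigma fun z => ?_
  have h2 : Summable fun h : (f ⁻¹' {z} : Set α) => a h := ha.subtype _
  have h3 := h2.hasSum
  rw [tsum_subtype] at h3
  exact h3

lemma fiberSum_nonneg (f : α → β) {a : α → ℝ} (ha : ∀ h, 0 ≤ a h) (z : β) : 0 ≤ fiberSum f a z :=
  tsum_nonneg fun _ => Set.indicator_nonneg (fun h _ => ha h) _

lemma exists_of_fiberSum_ne_zero {f : α → β} {a : α → ℝ} {z : β} (h : fiberSum f a z ≠ 0) :
    ∃ x, f x = z := by
  by_contra! hne
  refine h ?_
  have : f ⁻¹' {z} = ∅ := by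
    ext x
    simpa using hne x
  simp [fiberSum, this]

lemma fiberSum_sub (f : α → β) {a b : α → ℝ} (ha : Summable a) (hb : Summable b) (z : β) :
    fiberSum f (a - b) z = fiberSum f a z - fiberSum f b z := by
  rw [fiberSum, fiberSum, fiberSum, ← (ha.indicator _).tsum_sub (hb.indicator _)]
  exact tsum_congr fun x => congrFun (Set.indicator_sub _ a b) x

lemma abs_fiberSum_le (f : α → β) {a : α → ℝ} (ha : Summable a) (z : β) :
    |fiberSum f a z| ≤ fiberSum f (fun h => |a h|) z := by
  have h : ∀ x, |(f ⁻¹' {z}).indicator a x| = (f ⁻¹' {z}).indicator (fun h => |a h|) x := by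
    intro x
    by_cases hx : x ∈ f ⁻¹' {z} <;> simp [hx]
  calc |fiberSum f a z| ≤ ∑' x, |(f ⁻¹' {z}).indicator a x| := by
        simpa only [Real.norm_eq_abs, fiberSum] using
          norm_tsum_le_tsum_norm (f := (f ⁻¹' {z}).indicator a) (ha.indicator _).norm
    _ = _ := tsum_congr h

lemma tsum_abs_fiberSum_sub_le (f : α → β) {a b : α → ℝ} (ha : Summable a) (hb : Summable b) :
    ∑' z, |fiberSum f a z - fiberSum f b z| ≤ ∑' h, |a h - b h| := by
  have hab : Summable (a - b) := ha.sub hb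
  have hs := hasSum_fiberSum f hab.abs
  have hle := abs_fiberSum_le f hab
  have hsum : Summable fun z => |fiberSum f (a - b) z| :=
    Summable.of_nonneg_of_le (fun _ => abs_nonneg _) hle hs.summable
  calc ∑' z, |fiberSum f a z - fiberSum f b z| = ∑' z, |fiberSum f (a - b) z| := by
        simp_rw [fiberSum_sub f ha hb]
    _ ≤ ∑' z, fiberSum f (fun h => |(a - b) h|) z := hsum.tsum_le_tsum hle hs.summable
    _ = _ := hs.tsum_eq

lemma fiberSum_comp_equiv {α' : Type*} (e : α' ≃ α) (f : α → β) (a : α → ℝ) :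
    fiberSum (f ∘ e) (a ∘ e) = fiberSum f a := by
  funext z
  exact e.tsum_eq ((f ⁻¹' {z}).indicator a)

lemma measurable_fiberSum [Countable α] {X : Type*} [MeasurableSpace X] {f : X → α → β}
    {a : X → α → ℝ} {z : X → β} (hf : ∀ h, MeasurableSet {x | f x h = z x})
    (ha : ∀ h, Measurable fun x => a x h) : Measurable fun x => fiberSum (f x) (a x) (z x) :=
  Measurable.tsum fun h => (ha h).indicator (hf h)

end Pushforward

section Retraction

lemma exists_mem_classOf_mul {e : ℕ → Γ} (he : Function.Surjective e) (r : EqRelSpace Γ) (h : Γ) :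
    ∃ i, r.1 (1, h * e i) = true := by
  obtain ⟨i, hi⟩ := he h⁻¹
  exact ⟨i, by simpa [hi] using r.2.1 1⟩

/-- The first point of the class of the identity in the enumeration `h * e 0, h * e 1, …` of
the group. -/
def classRetraction {e : ℕ → Γ} (he : Function.Surjective e) (r : EqRelSpace Γ) (h : Γ) : Γ :=
  h * e (Nat.find (exists_mem_classOf_mul he r h))

variable {e : ℕ → Γ} (he : Function.Surjective e)

lemma classRetraction_mem (r : EqRelSpace Γ) (h : Γ) :
    r.1 (1, classRetraction he r h) = true :=
  Nat.find_spec (exists_mem_classOf_mul he r h)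

lemma classRetraction_shiftE {r : EqRelSpace Γ} {g : Γ} (hg : r.1 (1, g) = true) (h : Γ) :
    classRetraction he (shiftE g⁻¹ r) h = g⁻¹ * classRetraction he r (g * h) := by
  have key : ∀ i, (shiftE g⁻¹ r).1 (1, h * e i) = true ↔ r.1 (1, g * h * e i) = true := by
    intro i
    rw [shiftE_apply, inv_inv, mul_one, ← mul_assoc]
    exact ⟨fun hi => r.2.2.2 _ _ _ hg hi, fun hi => r.2.2.2 _ _ _ (r.2.2.1 _ _ hg) hi⟩
  have hfind : Nat.find (exists_mem_classOf_mul he (shiftE g⁻¹ r) h) =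
      Nat.find (exists_mem_classOf_mul he r (g * h)) := Nat.find_congr' (key _)
  rw [classRetraction, classRetraction, hfind]
  group

/-- Rerooting `r` at the image of `h` under the retraction onto the class of the identity. -/
def reroot (r : EqRelSpace Γ) (h : Γ) : EqRelSpace Γ :=
  shiftE (classRetraction he r h)⁻¹ r

lemma reroot_shiftE {r : EqRelSpace Γ} {g : Γ} (hg : r.1 (1, g) = true) (h : Γ) :
    reroot he (shiftE g⁻¹ r) h = reroot he r (g * h) := by
  simp [reroot, classRetraction_shiftE he hg, shiftE_shiftE]

lemma Rre_reroot (r : EqRelSpace Γ) (h : Γ) : Rre r (reroot he r h) :=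
  ⟨_, classRetraction_mem he r h, rfl⟩

lemma measurable_reroot (h : Γ) : Measurable fun r : EqRelSpace Γ => reroot he r h := by
  have hidx : Measurable fun r : EqRelSpace Γ => Nat.find (exists_mem_classOf_mul he r h) :=
    measurable_find _ fun k => measurable_eqRelSpace_coord _ (measurableSet_singleton true)
  have hF : Measurable fun p : ℕ × EqRelSpace Γ => shiftE (h * e p.1)⁻¹ p.2 :=
    measurable_from_prod_countable_right fun i => measurable_shiftE (h * e i)⁻¹
  exact hF.comp (hidx.prodMk measurable_id)

end Retraction

section Amenability

variable [Countable Γ]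

lemma exists_invariant_conull_subset {ρ : ProbabilityMeasure (EqRelSpace Γ)} (hρ : IsIRE ρ)
    {p : EqRelSpace Γ → Prop} (hp : ∀ᵐ r ∂ρ.toMeasure, p r) :
    ∃ U : Set (EqRelSpace Γ), MeasurableSet U ∧ ρ.toMeasure Uᶜ = 0 ∧
      (∀ γ : Γ, ∀ r ∈ U, shiftE γ r ∈ U) ∧ ∀ r ∈ U, p r := by
  obtain ⟨V, hVp, hVm, hV⟩ := exists_measurable_superset_of_null (ae_iff.1 hp)
  refine ⟨⋂ γ : Γ, shiftE γ ⁻¹' Vᶜ, MeasurableSet.iInter fun γ => measurable_shiftE γ hVm.compl,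
    ?_, fun γ r hr => ?_, fun r hr => ?_⟩
  · rw [Set.compl_iInter, measure_iUnion_null_iff]
    intro γ
    rw [← Set.preimage_compl, compl_compl, ← Measure.map_apply (measurable_shiftE γ) hVm, hρ γ, hV]
  · simp only [Set.mem_iInter, Set.mem_preimage] at hr ⊢
    intro δ
    rw [shiftE_shiftE]
    exact hr _
  · by_contra hn
    have := Set.mem_iInter.1 hr 1
    simp only [Set.mem_preimage, shiftE_one] at this
    exact this (hVp hn)

lemma IsAIRE.exists_borelAmenableRel {ρ : ProbabilityMeasure (EqRelSpace Γ)} (h : IsAIRE ρ) :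
    ∃ U : Set (EqRelSpace Γ), MeasurableSet U ∧ ρ.toMeasure Uᶜ = 0 ∧
      (∀ γ : Γ, ∀ r ∈ U, shiftE γ r ∈ U) ∧
      BorelAmenableRel (fun x y : U => Rre (x : EqRelSpace Γ) (y : EqRelSpace Γ)) := by
  obtain ⟨hρ, lam, hmeas, hnonneg, hsum, hae⟩ := h
  obtain ⟨U, hUm, hU, hinv, hconv⟩ := exists_invariant_conull_subset hρ hae
  obtain ⟨e, he⟩ := exists_surjective_nat Γ
  have hsummable : ∀ n r, Summable (lam n r) := fun n r => by
    by_contra hn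
    simpa [tsum_eq_zero_of_not_summable hn] using hsum n r
  have hmem : ∀ r ∈ U, ∀ h, reroot he r h ∈ U := fun r hr _ => hinv _ r hr
  refine ⟨U, hUm, hU, hinv, fun n x z =>
    fiberSum (fun h : Γ => (⟨reroot he x h, hmem x x.2 h⟩ : U)) (lam n x) z,
    fun n => ?_, fun n x z => fiberSum_nonneg _ (hnonneg n x) z, fun n x z hz => ?_,
    fun n x => ?_, fun x y hyx => ?_⟩
  · refine measurable_fiberSum (fun h => ?_)
      fun h => (hmeas n h).comp (measurable_subtype_coe.comp measurable_fst)
    simp only [Subtype.ext_iff (p := (· ∈ U))]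
    exact measurableSet_eqRelSpace_eq
      ((measurable_reroot he h).comp (measurable_subtype_coe.comp measurable_fst))
      (measurable_subtype_coe.comp measurable_snd)
  · obtain ⟨h, rfl⟩ := exists_of_fiberSum_ne_zero hz
    exact (Rre_reroot he _ h).symm
  · rw [(hasSum_fiberSum _ (hsummable n x)).tsum_eq, hsum]
  · obtain ⟨x, hx⟩ := x
    obtain ⟨g, hg, hgx⟩ := hyx
    dsimp only at hgx
    subst hgx
    refine squeeze_zero (fun n => tsum_nonneg fun _ => abs_nonneg _) (fun n => ?_)
      (hconv y y.2 g hg)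
    have hshift := fiberSum_comp_equiv (Equiv.mulLeft g)
      (fun h : Γ => (⟨reroot he y h, hmem y y.2 h⟩ : U)) (lam n y)
    have hfun : (fun h : Γ => (⟨reroot he (shiftE g⁻¹ y) h, hmem _ hx h⟩ : U)) =
        (fun h : Γ => (⟨reroot he y h, hmem y y.2 h⟩ : U)) ∘ Equiv.mulLeft g := by
      funext h
      exact Subtype.ext (reroot_shiftE he hg h)
    simp only [hfun]
    rw [← hshift]
    refine (tsum_abs_fiberSum_sub_le _ (hsummable n _)
      ((Equiv.mulLeft g).summable_iff.2 (hsummable n y))).trans_eq (tsum_congr fun h => ?_)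
    rw [abs_sub_comm]
    rfl

lemma isAIRE_of_borelAmenableRel {ρ : ProbabilityMeasure (EqRelSpace Γ)} (hρ : IsIRE ρ)
    (hfree : ∀ᵐ r ∂ρ.toMeasure, r ∈ freePart Γ) {U : Set (EqRelSpace Γ)} (hUm : MeasurableSet U)
    (hU : ρ.toMeasure Uᶜ = 0) (hinv : ∀ γ : Γ, ∀ r ∈ U, shiftE γ r ∈ U)
    (hS : BorelAmenableRel (fun x y : U => Rre (x : EqRelSpace Γ) (y : EqRelSpace Γ))) :
    IsAIRE ρ := by
  classical
  obtain ⟨η, hmeas, hnonneg, hsupp, hsum, hconv⟩ := hS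
  have horbit : ∀ (x : U), (x : EqRelSpace Γ) ∈ freePart Γ → ∀ f : U → ℝ,
      (∀ z, f z ≠ 0 → Rre (x : EqRelSpace Γ) z) →
      ∑' g : Γ, f ⟨shiftE g⁻¹ x, hinv _ _ x.2⟩ = ∑' z, f z := by
    intro x hx f hf
    refine Function.Injective.tsum_eq (g := fun g : Γ => (⟨shiftE g⁻¹ x, hinv _ _ x.2⟩ : U))
      (fun a b hab => ?_) fun z hz => ?_
    · exact inv_injective (shiftE_left_injective hx (congrArg Subtype.val hab))
    · obtain ⟨γ, -, hγ⟩ := hf z hz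
      exact ⟨γ, Subtype.ext hγ.symm⟩
  set V : Set (EqRelSpace Γ) := U ∩ freePart Γ
  have hVm : MeasurableSet V := hUm.inter measurableSet_freePart
  refine ⟨hρ, fun n r g => if h : r ∈ V then
    η n ⟨r, h.1⟩ ⟨shiftE g⁻¹ r, hinv _ _ h.1⟩ else if g = 1 then 1 else 0,
    fun n g => ?_, fun n r g => ?_, fun n r => ?_, ?_⟩
  · refine Measurable.dite (s := V)
      (f := fun r : V => η n ⟨r, r.2.1⟩ ⟨shiftE g⁻¹ r, hinv _ _ r.2.1⟩) ?_
      (g := fun _ => if g = 1 then 1 else 0) measurable_const hVm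
    exact (hmeas n).comp ((measurable_subtype_coe.subtype_mk).prodMk
      (((measurable_shiftE g⁻¹).comp measurable_subtype_coe).subtype_mk))
  · dsimp only
    split_ifs <;> simp [hnonneg]
  · by_cases h : r ∈ V
    · simp only [h, dif_pos]
      rw [horbit ⟨r, h.1⟩ h.2 (η n ⟨r, h.1⟩) fun z hz => (hsupp n _ z hz).symm, hsum]
    · simp [h]
  · have hUae : ∀ᵐ r ∂ρ.toMeasure, r ∈ U := hU
    filter_upwards [hUae, hfree] with r hrU hrF g hg
    have hr : r ∈ V := ⟨hrU, hrF⟩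
    have hgr : shiftE g⁻¹ r ∈ V := ⟨hinv _ _ hrU, shiftE_mem_freePart _ hrF⟩
    simp only [hr, hgr, dif_pos]
    refine (hconv ⟨shiftE g⁻¹ r, hgr.1⟩ ⟨r, hrU⟩ ⟨g, hg, rfl⟩).congr fun n => ?_
    rw [← horbit ⟨r, hrU⟩ hrF]
    · rw [← (Equiv.mulLeft g).tsum_eq]
      refine tsum_congr fun h => ?_
      rw [abs_sub_comm]
      simp [shiftE_shiftE]
    · intro z hz
      by_cases hz' : η n ⟨r, hrU⟩ z = 0
      · have : η n ⟨shiftE g⁻¹ r, hgr.1⟩ z ≠ 0 := by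
          intro h0
          simp [h0, hz'] at hz
        obtain ⟨γ, hγ, hzγ⟩ := (hsupp n _ _ this).symm
        refine ⟨g * γ, ?_, ?_⟩
        · rw [shiftE_apply, inv_inv, mul_one] at hγ
          exact r.2.2.2 _ _ _ hg hγ
        · rw [hzγ, shiftE_shiftE, mul_inv_rev]
      · exact (hsupp n _ _ hz').symm

end Amenability

/-- For a free IRE `ρ`, amenability of `ρ` is equivalent to `ρ`-amenability of the
restricted rerooting relation: Borel amenability of the restriction of `R_re` to some
`ρ`-conull `Γ`-invariant Borel subset of `E`. -/
theorem free_IRE_amenable_iff_rerooting_amenable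
    {Γ : Type*} [Group Γ] [Countable Γ]
    (ρ : ProbabilityMeasure (EqRelSpace Γ)) (hρ : IsIRE ρ)
    (hfree : ∀ᵐ r ∂ρ.toMeasure, ∀ γ : Γ, γ ≠ 1 → shiftE γ r ≠ r) :
    IsAIRE ρ ↔
      ∃ U : Set (EqRelSpace Γ), MeasurableSet U ∧ ρ.toMeasure Uᶜ = 0 ∧
        (∀ γ : Γ, ∀ r ∈ U, shiftE γ r ∈ U) ∧
        BorelAmenableRel (fun x y : U => Rre (x : EqRelSpace Γ) (y : EqRelSpace Γ)) := by
  constructor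
  · exact fun h => h.exists_borelAmenableRel
  · rintro ⟨U, hUm, hU, hinv, hS⟩
    exact isAIRE_of_borelAmenableRel hρ hfree hUm hU hinv hS
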